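/- Consider n = 2 agents and m = 2 items with normalized valuations: agent i's valuation is (t_i, 1 - t_i) with t_i ∈ [0,1], and the prior for each agent draws t_i uniformly from [0,1] independently. Then there is no deterministic measurable mechanism x mapping reported pairs (b_1, b_2) ∈ [0,1]² to allocations of the two items such that (1) for every reported pair, the output allocation is ex-post fractionally Pareto optimal (fPO) and fulfilling with respect to the reported valuations, and (2) x is Bayesian incentive compatible for this uniform prior, i.e., for every agent i, true value t_i, and report b_i, E_{t_{-i} ~ U[0,1]}[u_i(x(t_i, t_{-i}))] ≥ E_{t_{-i} ~ U[0,1]}[u_i(x(b_i, t_{-i}))], with u_i measured under t_i. -/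

import Mathlib

open MeasureTheory


/-- The normalized valuation `(t, 1 - t)` over the two items. -/
noncomputable def val2 (t : ℝ) : Fin 2 → ℝ := fun j => if j = 0 then t else 1 - t

/-- Utility of a bundle of (some of) the two items under the valuation `(t, 1 - t)`. -/
noncomputable def util2 (t : ℝ) (a : Fin 2 → Bool) : ℝ :=
  ∑ j : Fin 2, if a j then val2 t j else 0

/-- An allocation of the two items among the two agents: each item goes to exactly one agent. -/
def IsAlloc2 (a : Fin 2 → Fin 2 → Bool) : Prop :=
  ∀ j : Fin 2, ∃! i : Fin 2, a i j = true

/-- `f` is anonymous (symmetric) on nonnegative utility profiles. -/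
def Anonymous (f : ℝ → ℝ → ℝ) : Prop :=
  ∀ a b : ℝ, 0 ≤ a → 0 ≤ b → f a b = f b a

/-- `f` is strictly monotone on nonnegative utility profiles: coordinatewise weakly larger
and not equal implies strictly larger welfare. -/
def StrictlyMonotoneWelfare (f : ℝ → ℝ → ℝ) : Prop :=
  ∀ a b a' b' : ℝ, 0 ≤ a' → 0 ≤ b' → a' ≤ a → b' ≤ b → (a, b) ≠ (a', b') → f a' b' < f a b

/-- The Pigou–Dalton principle on nonnegative utility profiles: a mean-preserving
reduction of inequality between two agents weakly increases welfare. -/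
def PigouDalton (f : ℝ → ℝ → ℝ) : Prop :=
  ∀ x1 x2 y1 y2 : ℝ, 0 ≤ x2 → x1 + x2 = y1 + y2 → x2 < x1 → y1 < x1 → x2 < y1 →
    f x1 x2 ≤ f y1 y2

/-- A fractional allocation of the two items: nonnegative shares, each item fully allocated. -/
def FracAlloc (z : Fin 2 → Fin 2 → ℝ) : Prop :=
  (∀ i j, 0 ≤ z i j) ∧ ∀ j, z 0 j + z 1 j = 1

/-- Utility of a fractional bundle `zi` under the valuation `(t, 1 - t)`. -/
noncomputable def fracUtil (t : ℝ) (zi : Fin 2 → ℝ) : ℝ :=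
  ∑ j : Fin 2, val2 t j * zi j

/-- A deterministic allocation is fractionally Pareto optimal (fPO) w.r.t. the reported
pair `b` iff no fractional allocation gives every agent at least her utility and some
agent strictly more. -/
noncomputable def IsFPO (b : Fin 2 → ℝ) (a : Fin 2 → Fin 2 → Bool) : Prop :=
  ¬ ∃ z : Fin 2 → Fin 2 → ℝ, FracAlloc z ∧
      (∀ i, util2 (b i) (a i) ≤ fracUtil (b i) (z i)) ∧
      ∃ i, util2 (b i) (a i) < fracUtil (b i) (z i)

/-- A deterministic allocation is fulfilling iff every agent who positively values at
least `n = 2` items receives a bundle of strictly positive utility. -/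
noncomputable def Fulfilling (b : Fin 2 → ℝ) (a : Fin 2 → Fin 2 → Bool) : Prop :=
  ∀ i : Fin 2, 2 ≤ (Finset.univ.filter fun j => 0 < val2 (b i) j).card →
    0 < util2 (b i) (a i)

/-- On an interior profile with `b 1 ≠ b 0`, a fulfilling fPO allocation gives agent `0` exactly
one item: the first iff she values it more than agent `1` does. -/
lemma util2_of_isFPO_of_fulfilling {b : Fin 2 → ℝ} {a : Fin 2 → Fin 2 → Bool}
    (h0 : ∀ i, 0 < b i) (h1 : ∀ i, b i < 1) (hne : b 1 ≠ b 0)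
    (ha : IsAlloc2 a) (hp : IsFPO b a) (hf : Fulfilling b a) (t : ℝ) :
    util2 t (a 0) = if b 1 < b 0 then t else 1 - t := by
  have hpos : ∀ i j, 0 < val2 (b i) j := by
    intro i j
    have := h0 i
    have := h1 i
    unfold val2
    split_ifs <;> linarith
  have hu : ∀ i, 0 < util2 (b i) (a i) := fun i => hf i <| by
    rw [Finset.filter_true_of_mem fun j _ => hpos i j]
    simp
  have hu0 := hu 0
  have hu1 := hu 1
  have hc : ∀ j, a 1 j = !a 0 j := by
    intro j
    have h := ha j
    cases e0 : a 0 j <;> cases e1 : a 1 j <;>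
      simp [ExistsUnique, Fin.exists_fin_two, Fin.forall_fin_two, e0, e1] at h ⊢
  have h00 := h0 0
  have h01 := h0 1
  have h10 := h1 0
  have h11 := h1 1
  cases e0 : a 0 0 <;> cases e1 : a 0 1 <;>
    simp only [util2, val2, Fin.sum_univ_two, hc, e0, e1] at hu0 hu1 ⊢ <;>
    simp at hu0 hu1 ⊢
  · intro hlt
    refine (hp ⟨fun i _ => if i = 0 then 1 - b 0 else b 0, ⟨?_, ?_⟩, ?_, 1, ?_⟩).elim
    · intro i j
      dsimp only
      split_ifs <;> linarith
    · intro j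
      simp
    · simp only [Fin.forall_fin_two, util2, fracUtil, val2, Fin.sum_univ_two, hc, e0, e1]
      constructor <;> simp <;> nlinarith
    · simp only [util2, fracUtil, val2, Fin.sum_univ_two, hc, e0, e1]
      simp
      nlinarith
  · intro hle
    have hlt := lt_of_le_of_ne hle hne.symm
    refine (hp ⟨fun i _ => if i = 0 then b 0 else 1 - b 0, ⟨?_, ?_⟩, ?_, 1, ?_⟩).elim
    · intro i j
      dsimp only
      split_ifs <;> linarith
    · intro j
      simp
    · simp only [Fin.forall_fin_two, util2, fracUtil, val2, Fin.sum_univ_two, hc, e0, e1]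
      constructor <;> simp <;> nlinarith
    · simp only [util2, fracUtil, val2, Fin.sum_univ_two, hc, e0, e1]
      simp
      nlinarith

lemma setIntegral_Icc_ite_lt {r : ℝ} (h0 : 0 ≤ r) (h1 : r ≤ 1) (c d : ℝ) :
    ∫ s in Set.Icc (0 : ℝ) 1, (if s < r then c else d) = r * c + (1 - r) * d := by
  have hS : Set.Iio r ∩ Set.Icc (0 : ℝ) 1 = Set.Ico 0 r := by
    ext s
    simp only [Set.mem_inter_iff, Set.mem_Iio, Set.mem_Icc, Set.mem_Ico]
    constructor
    · rintro ⟨h, h', -⟩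
      exact ⟨h', h⟩
    · rintro ⟨h, h'⟩
      exact ⟨h', h, by linarith⟩
  have he : ∀ s : ℝ, (if s < r then c else d) = d + (Set.Iio r).indicator (fun _ => c - d) s := by
    intro s
    by_cases h : s < r <;> simp [h]
  simp_rw [he]
  rw [integral_add (integrable_const _) ((integrable_const _).indicator measurableSet_Iio),
    integral_indicator measurableSet_Iio, Measure.restrict_restrict measurableSet_Iio, hS]
  simp [h0]
  ring

/-- For two agents with normalized valuations `(t_i, 1 - t_i)`, `t_i` drawn i.i.d.
uniformly from `[0,1]`: no deterministic measurable mechanism always outputs ex-post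
fPO and fulfilling allocations (w.r.t. the reported valuations, on every reported pair
in `[0,1]²`) while being Bayesian incentive compatible for this uniform prior. -/
theorem stmt15 :
    ¬ ∃ M : (Fin 2 → ℝ) → (Fin 2 → Fin 2 → Bool),
        Measurable M ∧
        (∀ b : Fin 2 → ℝ, (∀ i, b i ∈ Set.Icc (0 : ℝ) 1) →
          IsAlloc2 (M b) ∧ IsFPO b (M b) ∧ Fulfilling b (M b)) ∧
        (∀ (i : Fin 2) (t r : ℝ), t ∈ Set.Icc (0 : ℝ) 1 → r ∈ Set.Icc (0 : ℝ) 1 →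
          ∫ s in Set.Icc (0 : ℝ) 1, util2 t (M (fun i' => if i' = i then r else s) i) ≤
            ∫ s in Set.Icc (0 : ℝ) 1, util2 t (M (fun i' => if i' = i then t else s) i)) := by
  rintro ⟨M, -, hM, hB⟩
  have key : ∀ t r : ℝ, 0 < r → r < 1 →
      ∫ s in Set.Icc (0 : ℝ) 1, util2 t (M (fun i' => if i' = 0 then r else s) 0) =
        r * t + (1 - r) * (1 - t) := by
    intro t r h0 h1
    rw [← setIntegral_Icc_ite_lt h0.le h1.le, integral_Icc_eq_integral_Ioo,
      integral_Icc_eq_integral_Ioo]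
    refine setIntegral_congr_ae measurableSet_Ioo ?_
    filter_upwards [Measure.ae_ne volume r] with s hs hs'
    obtain ⟨ha, hp, hf⟩ := hM (fun i' => if i' = 0 then r else s) (by
      simp [Fin.forall_fin_two, h0.le, h1.le, hs'.1.le, hs'.2.le])
    simpa using util2_of_isFPO_of_fulfilling (by simp [Fin.forall_fin_two, h0, hs'.1])
      (by simp [Fin.forall_fin_two, h1, hs'.2]) (by simpa using hs) ha hp hf t
  have h := hB 0 (3 / 4) (7 / 8) (by norm_num) (by norm_num)
  rw [key _ _ (by norm_num) (by norm_num), key _ _ (by norm_num) (by norm_num)] at h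
  norm_num at h
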